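/- Let (e_1,…,e_n) be an orthonormal basis of V and X, Y, Z ∈ V. Then Σ_{j=1}^n tr(c̄(X)∘c̄(Y)∘c̄(Z)∘c(e_j)∘c̄(X)∘c̄(Y)∘c̄(Z)∘c(e_j)) = n·2^n·[−‖X‖²‖Y‖²‖Z‖² + 2‖X‖²⟨Y,Z⟩² + 2‖Y‖²⟨X,Z⟩² + 2‖Z‖²⟨X,Y⟩² − 4⟨X,Y⟩⟨X,Z⟩⟨Y,Z⟩]. -/

import Mathlib

open scoped RealInnerProductSpace

noncomputable section

variable {V : Type*} [NormedAddCommGroup V] [InnerProductSpace ℝ V]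

/-- Left exterior multiplication `ε(v)` on the exterior algebra `ΛV`. -/
def extMul (v : V) : Module.End ℝ (ExteriorAlgebra ℝ V) :=
  LinearMap.mulLeft ℝ (ExteriorAlgebra.ι ℝ v)

/-- Interior multiplication (contraction) `ι(v)` on the exterior algebra `ΛV`:
the unique antiderivation with `ι(v) w = ⟪v, w⟫` for `w ∈ V`. -/
def intMul (v : V) : Module.End ℝ (ExteriorAlgebra ℝ V) :=
  CliffordAlgebra.contractLeft (Q := (0 : QuadraticForm ℝ V)) (innerₛₗ ℝ v)

/-- The Clifford action `c(v) = ε(v) - ι(v)`. -/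
def cl (v : V) : Module.End ℝ (ExteriorAlgebra ℝ V) := extMul v - intMul v

/-- The Clifford action `c̄(v) = ε(v) + ι(v)`. -/
def clBar (v : V) : Module.End ℝ (ExteriorAlgebra ℝ V) := extMul v + intMul v

/-- Trace of an endomorphism of `ΛV`. -/
abbrev trΛ : Module.End ℝ (ExteriorAlgebra ℝ V) →ₗ[ℝ] ℝ :=
  LinearMap.trace ℝ (ExteriorAlgebra ℝ V)

theorem intMul_ι_mul (v w : V) (x : ExteriorAlgebra ℝ V) :
    intMul v (ExteriorAlgebra.ι ℝ w * x) = ⟪v, w⟫ • x - ExteriorAlgebra.ι ℝ w * intMul v x :=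
  CliffordAlgebra.contractLeft_ι_mul (Q := (0 : QuadraticForm ℝ V)) (d := innerₛₗ ℝ v) w x

theorem clBar_mul_clBar (v w : V) :
    clBar v * clBar w = (2 * ⟪v, w⟫) • 1 - clBar w * clBar v := by
  refine LinearMap.ext fun x => ?_
  have h₁ : ExteriorAlgebra.ι ℝ v * (ExteriorAlgebra.ι ℝ w * x) +
      ExteriorAlgebra.ι ℝ w * (ExteriorAlgebra.ι ℝ v * x) = 0 := by
    rw [← mul_assoc, ← mul_assoc, ← add_mul, ExteriorAlgebra.ι_add_mul_swap, zero_mul]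
  have h₂ : intMul v (intMul w x) = -intMul w (intMul v x) :=
    CliffordAlgebra.contractLeft_comm _ _ x
  have h₃ := intMul_ι_mul v w x
  have h₄ := intMul_ι_mul w v x
  rw [real_inner_comm] at h₄
  simp only [clBar, Module.End.mul_apply, LinearMap.add_apply, LinearMap.sub_apply,
    LinearMap.smul_apply, Module.End.one_apply, extMul, LinearMap.mulLeft_apply, mul_add,
    h₂, h₃, h₄, two_mul, add_smul, eq_neg_of_add_eq_zero_left h₁]
  abel

theorem cl_mul_clBar (v w : V) : cl v * clBar w = -(clBar w * cl v) := by
  refine LinearMap.ext fun x => ?_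
  have h₁ : ExteriorAlgebra.ι ℝ v * (ExteriorAlgebra.ι ℝ w * x) +
      ExteriorAlgebra.ι ℝ w * (ExteriorAlgebra.ι ℝ v * x) = 0 := by
    rw [← mul_assoc, ← mul_assoc, ← add_mul, ExteriorAlgebra.ι_add_mul_swap, zero_mul]
  have h₂ : intMul v (intMul w x) = -intMul w (intMul v x) :=
    CliffordAlgebra.contractLeft_comm _ _ x
  have h₃ := intMul_ι_mul v w x
  have h₄ := intMul_ι_mul w v x
  rw [real_inner_comm] at h₄
  simp only [cl, clBar, Module.End.mul_apply, LinearMap.add_apply, LinearMap.sub_apply,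
    LinearMap.neg_apply, extMul, LinearMap.mulLeft_apply, mul_add,
    mul_sub, h₂, h₃, h₄, eq_neg_of_add_eq_zero_left h₁]
  abel

theorem cl_mul_self (v : V) : cl v * cl v = -(⟪v, v⟫ • 1) := by
  refine LinearMap.ext fun x => ?_
  have h₁ : ExteriorAlgebra.ι ℝ v * (ExteriorAlgebra.ι ℝ v * x) = 0 := by
    rw [← mul_assoc, ExteriorAlgebra.ι_sq_zero, zero_mul]
  have h₂ : intMul v (intMul v x) = 0 := CliffordAlgebra.contractLeft_contractLeft _ x
  simp only [cl, Module.End.mul_apply, LinearMap.sub_apply, LinearMap.neg_apply,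
    LinearMap.smul_apply, Module.End.one_apply, extMul, LinearMap.mulLeft_apply, mul_sub,
    h₁, h₂, intMul_ι_mul]
  abel

theorem trΛ_one [FiniteDimensional ℝ V] :
    trΛ (1 : Module.End ℝ (ExteriorAlgebra ℝ V)) = 2 ^ Module.finrank ℝ V := by
  have b := (Module.finBasis ℝ V).ExteriorAlgebra
  have := Module.Finite.of_basis b
  rw [LinearMap.trace_one, Module.finrank_eq_card_basis b]
  simp

section Clifford

variable {A : Type*} [Ring A] [Algebra ℝ A] {f g : V → A}

theorem clifford_mul_self (hf : ∀ v w, f v * f w = (2 * ⟪v, w⟫) • 1 - f w * f v) (v : V) :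
    f v * f v = ⟪v, v⟫ • 1 := by
  have h := hf v v
  rw [eq_sub_iff_add_eq, ← two_smul ℝ (f v * f v), mul_smul] at h
  exact smul_right_injective _ (two_ne_zero (α := ℝ)) h

theorem clifford_mul_three_reverse (hf : ∀ v w, f v * f w = (2 * ⟪v, w⟫) • 1 - f w * f v)
    (x y z : V) :
    f z * f y * f x =
      (2 * ⟪x, y⟫) • f z - (2 * ⟪x, z⟫) • f y + (2 * ⟪y, z⟫) • f x - f x * f y * f z := by
  rw [hf z y, sub_mul, mul_assoc, hf z x, mul_sub, ← mul_assoc,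
    hf y x, sub_mul, real_inner_comm z y, real_inner_comm z x, real_inner_comm y x]
  simp only [smul_mul_assoc, mul_smul_comm, one_mul, mul_one]
  abel

theorem clifford_mul_three_mul_sq
    (hg : ∀ v, g v * g v = -(⟪v, v⟫ • 1)) (hgf : ∀ v w, g v * f w = -(f w * g v)) (x y z v : V) :
    f x * f y * f z * g v * (f x * f y * f z * g v) =
      ⟪v, v⟫ • (f x * f y * f z * (f x * f y * f z)) := by
  have h : g v * (f x * f y * f z) = -(f x * f y * f z * g v) := by
    rw [← mul_assoc, ← mul_assoc, hgf, neg_mul, mul_assoc (f x), hgf,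
      mul_neg, neg_neg, mul_assoc, mul_assoc, mul_assoc, hgf]
    simp only [mul_neg, mul_assoc]
  rw [← mul_assoc, mul_assoc _ (g v), h, mul_neg, neg_mul, mul_assoc, mul_assoc _ (g v), hg]
  simp

variable (τ : A →ₗ[ℝ] ℝ)

theorem trace_clifford_mul (hτ : ∀ a b, τ (a * b) = τ (b * a))
    (hf : ∀ v w, f v * f w = (2 * ⟪v, w⟫) • 1 - f w * f v) (v w : V) :
    τ (f v * f w) = ⟪v, w⟫ * τ 1 := by
  have h := congrArg τ (hf v w)
  rw [map_sub, map_smul, hτ (f w), smul_eq_mul] at h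
  linarith

theorem trace_clifford_mul_four (hτ : ∀ a b, τ (a * b) = τ (b * a))
    (hf : ∀ v w, f v * f w = (2 * ⟪v, w⟫) • 1 - f w * f v) (x y z w : V) :
    τ (f x * f y * f z * f w) =
      (⟪x, y⟫ * ⟪z, w⟫ - ⟪x, z⟫ * ⟪y, w⟫ + ⟪x, w⟫ * ⟪y, z⟫) * τ 1 := by
  have h : f x * f y * f z * f w =
      (2 * ⟪x, y⟫) • (f z * f w) - (2 * ⟪x, z⟫) • (f y * f w) +
      (2 * ⟪x, w⟫) • (f y * f z) - f y * f z * f w * f x := by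
    rw [hf x y, sub_mul, sub_mul, mul_assoc (f y), hf x z, mul_sub,
      sub_mul, ← mul_assoc (f y), mul_assoc _ (f x), hf x w, mul_sub]
    simp only [smul_mul_assoc, mul_smul_comm, one_mul, mul_one, mul_assoc]
    abel
  have h' := congrArg τ h
  have hc : τ (f y * f z * f w * f x) = τ (f x * f y * f z * f w) := by
    rw [hτ]
    simp only [mul_assoc]
  rw [map_sub, map_add, map_sub, hc] at h'
  simp only [map_smul, smul_eq_mul, trace_clifford_mul τ hτ hf] at h'
  linarith

theorem trace_sq_clifford_mul_three (hτ : ∀ a b, τ (a * b) = τ (b * a))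
    (hf : ∀ v w, f v * f w = (2 * ⟪v, w⟫) • 1 - f w * f v) (x y z : V) :
    τ (f x * f y * f z * (f x * f y * f z)) =
      (-(‖x‖ ^ 2 * ‖y‖ ^ 2 * ‖z‖ ^ 2) + 2 * ‖x‖ ^ 2 * ⟪y, z⟫ ^ 2 +
        2 * ‖y‖ ^ 2 * ⟪x, z⟫ ^ 2 + 2 * ‖z‖ ^ 2 * ⟪x, y⟫ ^ 2 -
        4 * (⟪x, y⟫ * ⟪x, z⟫ * ⟪y, z⟫)) * τ 1 := by
  have hr : f x * f y * f z * (f z * f y * f x) = (⟪x, x⟫ * ⟪y, y⟫ * ⟪z, z⟫) • 1 := by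
    have h : f x * f y * f z * (f z * f y * f x) = f x * (f y * (f z * f z) * f y) * f x := by
      simp only [mul_assoc]
    rw [h]
    simp only [clifford_mul_self hf, smul_mul_assoc, mul_smul_comm, mul_one, smul_smul]
    congr 1
    ring
  have h := congrArg τ hr
  rw [clifford_mul_three_reverse hf x y z, mul_sub, mul_add, mul_sub] at h
  simp only [mul_smul_comm, map_sub, map_add, map_smul, smul_eq_mul,
    trace_clifford_mul_four τ hτ hf] at h
  simp only [← real_inner_self_eq_norm_sq]
  rw [real_inner_comm y z, real_inner_comm x z, real_inner_comm x y] at *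
  linarith

end Clifford

theorem clBar_mul_three_mul_cl_sq (x y z v : V) :
    clBar x * clBar y * clBar z * cl v * (clBar x * clBar y * clBar z * cl v) =
      ⟪v, v⟫ • (clBar x * clBar y * clBar z * (clBar x * clBar y * clBar z)) :=
  clifford_mul_three_mul_sq cl_mul_self cl_mul_clBar x y z v

theorem trΛ_sq_clBar_mul_three (x y z : V) :
    trΛ (clBar x * clBar y * clBar z * (clBar x * clBar y * clBar z)) =
      (-(‖x‖ ^ 2 * ‖y‖ ^ 2 * ‖z‖ ^ 2) + 2 * ‖x‖ ^ 2 * ⟪y, z⟫ ^ 2 +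
        2 * ‖y‖ ^ 2 * ⟪x, z⟫ ^ 2 + 2 * ‖z‖ ^ 2 * ⟪x, y⟫ ^ 2 -
        4 * (⟪x, y⟫ * ⟪x, z⟫ * ⟪y, z⟫)) * trΛ (1 : Module.End ℝ (ExteriorAlgebra ℝ V)) :=
  trace_sq_clifford_mul_three trΛ (LinearMap.trace_mul_comm ℝ) clBar_mul_clBar x y z

theorem trace_sum_cbarcbarcbar_XYZj [FiniteDimensional ℝ V] (n : ℕ)
    (e : OrthonormalBasis (Fin n) ℝ V) (X Y Z : V) :
    ∑ j : Fin n,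
        trΛ (clBar X ∘ₗ clBar Y ∘ₗ clBar Z ∘ₗ cl (e j) ∘ₗ
              clBar X ∘ₗ clBar Y ∘ₗ clBar Z ∘ₗ cl (e j))
      = (n : ℝ) * 2 ^ n *
          (-(‖X‖ ^ 2 * ‖Y‖ ^ 2 * ‖Z‖ ^ 2) + 2 * ‖X‖ ^ 2 * ⟪Y, Z⟫ ^ 2 +
            2 * ‖Y‖ ^ 2 * ⟪X, Z⟫ ^ 2 + 2 * ‖Z‖ ^ 2 * ⟪X, Y⟫ ^ 2 -
            4 * (⟪X, Y⟫ * ⟪X, Z⟫ * ⟪Y, Z⟫)) := by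
  have key (j : Fin n) :
      clBar X ∘ₗ clBar Y ∘ₗ clBar Z ∘ₗ cl (e j) ∘ₗ clBar X ∘ₗ clBar Y ∘ₗ clBar Z ∘ₗ cl (e j) =
        clBar X * clBar Y * clBar Z * (clBar X * clBar Y * clBar Z) := by
    have h := clBar_mul_three_mul_cl_sq X Y Z (e j)
    rw [real_inner_self_eq_norm_sq, e.orthonormal.1 j, one_pow, one_smul] at h
    rw [← h]
    simp only [mul_assoc]
    rfl
  have hn : Module.finrank ℝ V = n := by
    simpa using Module.finrank_eq_card_basis e.toBasis
  have htr := trΛ_sq_clBar_mul_three X Y Z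
  rw [trΛ_one, hn] at htr
  rw [Finset.sum_congr rfl fun j _ => (congrArg trΛ (key j)).trans htr, Finset.sum_const,
    Finset.card_univ, Fintype.card_fin, nsmul_eq_mul]
  ring
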